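/- Theorem 2 (Complexity of local block encodings): Let G = (V,E) be a finite connected simple graph containing an 8-shaped subgraph, namely two vertices u and w joined by three paths with pairwise disjoint edge sets: u = i_0, i_1, …, i_n = w; u = j_0, j_1, …, j_m = w; u = k_0, k_1, …, k_l = w. Let d ≥ 0 be an integer for which there exists an integer D with 1 ≤ D < min(n,m,l) such that, writing I_D, J_D, K_D for the sets of the first D edges of the three paths and R_D for the set of all remaining edges of the subgraph, no vertex of G is simultaneously within graph distance d of a vertex incident to an edge of R_D and within graph distance d of vertices incident to edges of two or more of the sets I_D, J_D, K_D. Then for any local block encoding of the fermionic modes on G, the code subspace C contains no state of the form U ψ where ψ is a product state ⊗_{v∈V} ψ_v and U is a circuit of local two-body gates of depth at most d. -/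

import Mathlib

open scoped Classical

/-- Basis index set of the tensor product `⊗_v ℂ^{dim v}`. -/
abbrev TIdx {V : Type*} (dim : V → ℕ) := (v : V) → Fin (dim v)

/-- A linear operator `M` on `⊗_v ℂ^{dim v}` is supported on `S ⊆ V` if `M = m ⊗ Id`. -/
def SupportedOn {V : Type*} (dim : V → ℕ) (S : Set V)
    (M : Matrix (TIdx dim) (TIdx dim) ℂ) : Prop :=
  ∃ m : Matrix ((v : S) → Fin (dim v.1)) ((v : S) → Fin (dim v.1)) ℂ,
    ∀ x y : TIdx dim, M x y =
      if ∀ v ∉ S, x v = y v then m (fun v => x v.1) (fun v => y v.1) else 0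

/-- Kronecker delta of two vertices, as a natural number exponent. -/
def kdelta {V : Type*} [DecidableEq V] (a b : V) : ℕ := if a = b then 1 else 0

/-- A local block encoding of the fermionic modes on `G` (see Definition 3). -/
def IsLocalBlockEncoding {V : Type*} [Fintype V] [DecidableEq V]
    (G : SimpleGraph V) (dim : V → ℕ)
    (A : V → V → Matrix (TIdx dim) (TIdx dim) ℂ)
    (B : V → Matrix (TIdx dim) (TIdx dim) ℂ)
    (C : Submodule ℂ (TIdx dim → ℂ)) : Prop :=
  (∀ k, SupportedOn dim {k} (B k)) ∧
  (∀ j k, G.Adj j k → SupportedOn dim {j, k} (A j k) ∧ A k j = - A j k) ∧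
  C ≠ ⊥ ∧
  (∀ k, ∀ ψ ∈ C, (B k).mulVec ψ ∈ C) ∧
  (∀ j k, G.Adj j k → ∀ ψ ∈ C, (A j k).mulVec ψ ∈ C) ∧
  (∀ j k, ∀ ψ ∈ C, (B j * B k - B k * B j).mulVec ψ = 0) ∧
  (∀ j k l, G.Adj j k → ∀ ψ ∈ C,
      (A j k * B l - ((-1 : ℂ) ^ (kdelta j l + kdelta k l)) • (B l * A j k)).mulVec ψ
        = 0) ∧
  (∀ j k l m, G.Adj j k → G.Adj l m → ∀ ψ ∈ C,
      (A j k * A l m -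
        ((-1 : ℂ) ^ (kdelta j l + kdelta k l + kdelta j m + kdelta k m)) •
          (A l m * A j k)).mulVec ψ = 0) ∧
  (∀ j k, G.Adj j k → ∀ ψ ∈ C, ((A j k).conjTranspose - A j k).mulVec ψ = 0) ∧
  (∀ k, ∀ ψ ∈ C, ((B k).conjTranspose - B k).mulVec ψ = 0) ∧
  (∀ j k, G.Adj j k → ∀ ψ ∈ C, (A j k ^ 2).mulVec ψ = ψ) ∧
  (∀ k, ∀ ψ ∈ C, (B k ^ 2).mulVec ψ = ψ) ∧
  (∀ (n : ℕ) (f : Fin (n + 1) → V), (∀ t, G.Adj (f t) (f (t + 1))) → ∀ ψ ∈ C,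
      Complex.I ^ (n + 1) •
        ((List.ofFn (fun t : Fin (n + 1) => A (f t) (f (t + 1)))).prod).mulVec ψ
        = ψ)

/-- A two-body gate: a unitary supported on `{j, k}` with `(j, k)` an edge of `G`. -/
def IsGate {V : Type*} [Fintype V] [DecidableEq V] (G : SimpleGraph V) (dim : V → ℕ)
    (g : Matrix (TIdx dim) (TIdx dim) ℂ × V × V) : Prop :=
  G.Adj g.2.1 g.2.2 ∧ g.1 ∈ Matrix.unitaryGroup (TIdx dim) ℂ ∧
    SupportedOn dim {g.2.1, g.2.2} g.1

/-- A layer: a product of two-body gates whose supports are pairwise disjoint. -/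
def IsLayer {V : Type*} [Fintype V] [DecidableEq V] (G : SimpleGraph V) (dim : V → ℕ)
    (L : Matrix (TIdx dim) (TIdx dim) ℂ) : Prop :=
  ∃ gs : List (Matrix (TIdx dim) (TIdx dim) ℂ × V × V),
    (∀ g ∈ gs, IsGate G dim g) ∧
    gs.Pairwise (fun g g' => ({g.2.1, g.2.2} : Set V) ∩ {g'.2.1, g'.2.2} = ∅) ∧
    L = (gs.map Prod.fst).prod

/-- A circuit of local two-body gates of depth at most `n`. -/
def IsCircuitOfDepthLE {V : Type*} [Fintype V] [DecidableEq V] (G : SimpleGraph V)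
    (dim : V → ℕ) (n : ℕ) (U : Matrix (TIdx dim) (TIdx dim) ℂ) : Prop :=
  ∃ Ls : List (Matrix (TIdx dim) (TIdx dim) ℂ),
    Ls.length ≤ n ∧ (∀ L ∈ Ls, IsLayer G dim L) ∧ U = Ls.prod

/-- The set of edges `{f t, f (t+1)}` of a walk `f`, for `a ≤ t < b`. -/
def pathEdges {V : Type*} (f : ℕ → V) (a b : ℕ) : Set (Sym2 V) :=
  {e | ∃ t, a ≤ t ∧ t < b ∧ e = s(f t, f (t + 1))}

/-- `x` is within graph distance `n` of a vertex incident to an edge of `F`. -/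
def NearEdges {V : Type*} (G : SimpleGraph V) (n : ℕ) (x : V)
    (F : Set (Sym2 V)) : Prop :=
  ∃ y : V, (∃ e ∈ F, y ∈ e) ∧ G.dist x y ≤ n

/-- An operator on `⊗_v ℂ^{dim v}` is local on `S` if it commutes with multiplication by functions
of the coordinates outside `S` and with substitution of values for those coordinates. -/
def IsLocal {V : Type*} [DecidableEq V] {dim : V → ℕ} (S : Set V)
    (M : Module.End ℂ (TIdx dim → ℂ)) : Prop :=
  (∀ p F : TIdx dim → ℂ, DependsOn p Sᶜ → M (p * F) = p * M F) ∧
  ∀ v ∉ S, ∀ (a : Fin (dim v)) (F : TIdx dim → ℂ) (x : TIdx dim),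
    M (fun z => F (Function.update z v a)) x = M F (Function.update x v a)

section Locality

variable {V : Type*} {dim : V → ℕ}

theorem dependsOn_of_update [Fintype V] [DecidableEq V]
    {T : Set V} {F : TIdx dim → ℂ}
    (h : ∀ v ∉ T, ∀ x a, F (Function.update x v a) = F x) : DependsOn F T := by
  intro x y hxy
  have key : ∀ s : Finset V, (∀ v ∈ s, v ∉ T) → F (s.piecewise y x) = F x := by
    intro s
    induction s using Finset.induction_on with
    | empty => intro _; simp
    | insert w s hw ih =>
      intro hs
      rw [Finset.piecewise_insert, h w (hs w (by simp))]
      exact ih fun v hv => hs v (by simp [hv])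
  rw [← key (Finset.univ.filter (· ∉ T)) (by simp)]
  congr 1
  funext v
  by_cases hv : v ∈ T <;> simp [Finset.piecewise, hv, hxy]

theorem IsLocal.one [DecidableEq V] (S : Set V) : IsLocal S (1 : Module.End ℂ (TIdx dim → ℂ)) :=
  ⟨fun _ _ _ => rfl, fun _ _ _ _ _ => rfl⟩

theorem IsLocal.mul [DecidableEq V] {S : Set V} {M N : Module.End ℂ (TIdx dim → ℂ)}
    (hM : IsLocal S M) (hN : IsLocal S N) : IsLocal S (M * N) := by
  refine ⟨fun p F hp => ?_, fun v hv a F x => ?_⟩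
  · simp only [Module.End.mul_apply]
    rw [hN.1 p F hp, hM.1 p _ hp]
  · simp only [Module.End.mul_apply]
    rw [← hM.2 v hv a (N F) x]
    refine congrFun (congrArg M (funext fun z => ?_)) x
    exact hN.2 v hv a F z

theorem IsLocal.smul [DecidableEq V] {S : Set V} {M : Module.End ℂ (TIdx dim → ℂ)}
    (hM : IsLocal S M) (s : ℂ) : IsLocal S (s • M) := by
  refine ⟨fun p F hp => ?_, fun v hv a F x => ?_⟩
  · simp only [LinearMap.smul_apply]
    rw [hM.1 p F hp, mul_smul_comm]
  · simp only [LinearMap.smul_apply, Pi.smul_apply]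
    rw [hM.2 v hv a F x]

theorem IsLocal.mono [DecidableEq V] {S T : Set V} {M : Module.End ℂ (TIdx dim → ℂ)}
    (hM : IsLocal S M) (h : S ⊆ T) : IsLocal T M :=
  ⟨fun p F hp => hM.1 p F fun _ _ hxy => hp fun v hv => hxy v fun hvS => hv (h hvS),
    fun v hv => hM.2 v fun hvS => hv (h hvS)⟩

theorem IsLocal.dependsOn [Fintype V] [DecidableEq V]
    {S T : Set V} {M : Module.End ℂ (TIdx dim → ℂ)} {F : TIdx dim → ℂ}
    (hM : IsLocal S M) (hF : DependsOn F T) (h : S ⊆ T) : DependsOn (M F) T := by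
  refine dependsOn_of_update fun v hv x a => ?_
  rw [← hM.2 v (fun hvS => hv (h hvS)) a F x]
  refine congrFun (congrArg M (funext fun z => ?_)) x
  exact hF fun w hw => Function.update_of_ne (fun e : w = v => hv (e ▸ hw)) _ _

theorem DependsOn.mono_set {S T : Set V} {F : TIdx dim → ℂ} (hF : DependsOn F S) (h : S ⊆ T) :
    DependsOn F T := fun _ _ hxy => hF fun v hv => hxy v (h hv)

theorem DependsOn.mul {T : Set V} {F F' : TIdx dim → ℂ} (hF : DependsOn F T)
    (hF' : DependsOn F' T) : DependsOn (F * F') T := fun x y hxy => by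
  simp only [Pi.mul_apply]
  rw [hF hxy, hF' hxy]

theorem IsLocal.commute [Fintype V] [DecidableEq V]
    {S T : Set V} {M N : Module.End ℂ (TIdx dim → ℂ)}
    (hM : IsLocal S M) (hN : IsLocal T N) (h : S ∩ T = ∅) : M * N = N * M := by
  have hST : S ⊆ Tᶜ := fun v hv hvT => (h ▸ (⟨hv, hvT⟩ : v ∈ S ∩ T) : v ∈ (∅ : Set V))
  have hTS : T ⊆ Sᶜ := fun v hv hvS => hST hvS hv
  refine LinearMap.pi_ext' fun y => LinearMap.ext_ring ?_
  obtain ⟨s, t, hs, ht, hst⟩ : ∃ s t : TIdx dim → ℂ, DependsOn s S ∧ DependsOn t Sᶜ ∧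
      (LinearMap.single ℂ (fun _ : TIdx dim => ℂ) y) 1 = s * t := by
    have hdep : ∀ R : Set V,
        DependsOn (fun x : TIdx dim => if ∀ v ∈ R, x v = y v then (1 : ℂ) else 0) R := by
      intro R x z hxz
      exact if_congr (forall₂_congr fun v hv => by rw [hxz v hv]) rfl rfl
    refine ⟨_, _, hdep S, hdep Sᶜ, ?_⟩
    funext x
    simp only [LinearMap.single_apply, Pi.mul_apply, Pi.single_apply]
    by_cases hx : x = y
    · simp [hx]
    · rw [if_neg hx]
      by_cases hS : ∀ v ∈ S, x v = y v
      · rw [if_neg (c := ∀ v ∈ Sᶜ, x v = y v), mul_zero]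
        exact fun hS' => hx (funext fun v => (em (v ∈ S)).elim (hS v) (hS' v))
      · rw [if_neg hS, zero_mul]
  simp only [LinearMap.comp_apply, Module.End.mul_apply]
  rw [hst, hN.1 s t (hs.mono_set hST), mul_comm s t, hM.1 t s ht, mul_comm s,
    hM.1 (N t) s (hN.dependsOn ht hTS), mul_comm t,
    hN.1 (M s) t ((hM.dependsOn hs le_rfl).mono_set hST), mul_comm]

theorem SupportedOn.isLocal [Fintype V] [DecidableEq V]
    {S : Set V} {M : Matrix (TIdx dim) (TIdx dim) ℂ}
    (h : SupportedOn dim S M) : IsLocal S (Matrix.toLin' M) := by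
  obtain ⟨m, hm⟩ := h
  refine ⟨fun p F hp => ?_, fun v hv a F x => ?_⟩
  · funext x
    simp only [Matrix.toLin'_apply, Matrix.mulVec, dotProduct, Pi.mul_apply, Finset.mul_sum]
    refine Finset.sum_congr rfl fun y _ => ?_
    rw [hm]
    split_ifs with hxy
    · rw [hp hxy]; ring
    · simp
  · simp only [Matrix.toLin'_apply, Matrix.mulVec, dotProduct]
    let σ : Equiv.Perm (TIdx dim) := Function.Involutive.toPerm
      (fun y => Function.update y v (Equiv.swap (x v) a (y v))) (fun y => by simp)
    rw [← Equiv.sum_comp σ (fun y => M (Function.update x v a) y * F y)]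
    refine Finset.sum_congr rfl fun y _ => ?_
    change _ = M _ (Function.update y v (Equiv.swap (x v) a (y v))) *
      F (Function.update y v (Equiv.swap (x v) a (y v)))
    have hne : ∀ w ∈ S, w ≠ v := fun w hw e => hv (e ▸ hw)
    rw [hm, hm]
    by_cases hy : y v = x v
    · rw [hy, Equiv.swap_apply_left]
      have hiff : (∀ w ∉ S, x w = y w) ↔
          ∀ w ∉ S, Function.update x v a w = Function.update y v a w := by
        refine forall₂_congr fun w _ => ?_
        by_cases hw : w = v
        · subst hw; simp [hy]
        · simp [hw]
      have hS : ∀ z : TIdx dim,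
          (fun w : S => Function.update z v a w.1) = fun w : S => z w.1 :=
        fun z => funext fun w => Function.update_of_ne (hne w.1 w.2) _ _
      simp only [hiff, hS]
    · split_ifs with hxy hxy' hxy'
      · exact absurd (hxy v hv).symm hy
      · exact absurd (hxy v hv).symm hy
      · have := hxy' v hv
        simp only [Function.update_self] at this
        exact absurd ((Equiv.swap (x v) a).injective
          (this.symm.trans (Equiv.swap_apply_left (x v) a).symm)) hy
      · simp

theorem SupportedOn.conjTranspose {S : Set V} {M : Matrix (TIdx dim) (TIdx dim) ℂ}
    (h : SupportedOn dim S M) : SupportedOn dim S M.conjTranspose := by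
  obtain ⟨m, hm⟩ := h
  refine ⟨m.conjTranspose, fun x y => ?_⟩
  simp only [Matrix.conjTranspose_apply, hm]
  split_ifs with h1 h2 h2
  · rfl
  · exact absurd (fun v hv => (h1 v hv).symm) h2
  · exact absurd (fun v hv => (h2 v hv).symm) h1
  · simp

end Locality

/-- The product of the factors `ψ v` over the sites in `T`, as a function on the basis indices. -/
noncomputable def partialProduct {V : Type*} [Fintype V] {dim : V → ℕ}
    (ψ : (v : V) → Fin (dim v) → ℂ) (T : Set V) (x : TIdx dim) : ℂ :=
  ∏ v with v ∈ T, ψ v (x v)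

/-- The restriction of `χ` to the coordinates in `X`, the others being those of `x₀`. -/
noncomputable def slice {V : Type*} {dim : V → ℕ} (X : Set V) (χ : TIdx dim → ℂ) (x₀ : TIdx dim)
    (x : TIdx dim) : ℂ :=
  χ (X.piecewise x x₀)

section ProductStates

variable {V : Type*} {dim : V → ℕ} {ψ : (v : V) → Fin (dim v) → ℂ}

theorem partialProduct_dependsOn [Fintype V] (T : Set V) : DependsOn (partialProduct ψ T) T := by
  intro x y hxy
  refine Finset.prod_congr rfl fun v hv => ?_
  rw [hxy v (by simpa using hv)]

theorem partialProduct_ne_zero [Fintype V] {y : TIdx dim} (hy : ∀ v, ψ v (y v) ≠ 0) (T : Set V) :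
    partialProduct ψ T y ≠ 0 :=
  Finset.prod_ne_zero_iff.2 fun v _ => hy v

theorem partialProduct_mul_of_disjoint [Fintype V] {I J : Set V} (h : Disjoint I J) :
    partialProduct ψ J * partialProduct ψ (I ∪ J)ᶜ = partialProduct ψ Iᶜ := by
  classical
  funext x
  simp only [partialProduct, Pi.mul_apply]
  rw [← Finset.prod_union]
  · refine Finset.prod_congr (Finset.ext fun v => ?_) fun _ _ => rfl
    have : v ∈ I → v ∉ J := fun a b => Set.disjoint_left.1 h a b
    simp only [Finset.mem_union, Finset.mem_filter, Finset.mem_univ, true_and, Set.mem_compl_iff,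
      Set.mem_union]
    tauto
  · rw [Finset.disjoint_left]
    intro v hv hv'
    simp only [Finset.mem_filter, Finset.mem_univ, true_and, Set.mem_compl_iff,
      Set.mem_union] at hv hv'
    exact hv' (Or.inr hv)

theorem exists_mul_partialProduct [Fintype V] [DecidableEq V] {y : TIdx dim}
    (hy : ∀ v, ψ v (y v) ≠ 0)
    {η : TIdx dim → ℂ} {T : Set V}
    (h : ∀ v ∉ T, ∀ x a, η x * ψ v a = η (Function.update x v a) * ψ v (x v)) :
    ∃ F, DependsOn F T ∧ η = F * partialProduct ψ Tᶜ := by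
  have key : ∀ (x : TIdx dim) (s : Finset V), (∀ v ∈ s, v ∉ T) →
      η x * ∏ v ∈ s, ψ v (y v) = η (s.piecewise y x) * ∏ v ∈ s, ψ v (x v) := by
    intro x s
    induction s using Finset.induction_on with
    | empty => intro _; simp
    | insert w s hw ih =>
      intro hs
      have h1 := h w (hs w (by simp)) (s.piecewise y x) (y w)
      rw [Finset.piecewise_eq_of_notMem _ _ _ hw] at h1
      rw [Finset.piecewise_insert, Finset.prod_insert hw, Finset.prod_insert hw, ← mul_assoc,
        ← mul_assoc, ← h1, mul_right_comm, ih fun v hv => hs v (by simp [hv])]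
      ring
  obtain ⟨s, hs, hprod⟩ : ∃ s : Finset V, (∀ v, v ∈ s ↔ v ∉ T) ∧
      ∀ x, partialProduct ψ Tᶜ x = ∏ v ∈ s, ψ v (x v) :=
    ⟨_, fun v => by simp only [Finset.mem_filter_univ, Set.mem_compl_iff], fun x => rfl⟩
  refine ⟨fun x => η (s.piecewise y x) / partialProduct ψ Tᶜ y, fun x z hxz => ?_, ?_⟩
  · refine congrArg (fun t => η t / _) (funext fun v => ?_)
    by_cases hv : v ∈ T <;> simp [Finset.piecewise, hv, hxz, hs]
  · funext x
    rw [Pi.mul_apply, div_mul_eq_mul_div, eq_div_iff (partialProduct_ne_zero hy _), hprod, hprod]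
    exact key x s fun v hv => (hs v).1 hv

theorem IsLocal.factor [DecidableEq V] {S : Set V} {M : Module.End ℂ (TIdx dim → ℂ)}
    (hM : IsLocal S M) {v : V} (hv : v ∉ S) {η : TIdx dim → ℂ}
    (h : ∀ x a, η x * ψ v a = η (Function.update x v a) * ψ v (x v)) (x : TIdx dim)
    (a : Fin (dim v)) : M η x * ψ v a = M η (Function.update x v a) * ψ v (x v) := by
  have hdep : DependsOn (fun x : TIdx dim => ψ v (x v)) Sᶜ := fun x y hxy => by
    simp only [hxy v hv]
  have h1 := congrFun (hM.1 _ (fun x => η (Function.update x v a)) hdep) x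
  have h2 : (fun x : TIdx dim => ψ v (x v)) * (fun x => η (Function.update x v a)) =
      ψ v a • η := by
    funext z
    simp only [Pi.mul_apply, Pi.smul_apply, smul_eq_mul]
    rw [mul_comm, ← h, mul_comm]
  rw [h2, map_smul] at h1
  simp only [Pi.mul_apply, Pi.smul_apply, smul_eq_mul] at h1
  rw [hM.2 v hv] at h1
  rw [mul_comm, h1, mul_comm]

theorem partialProduct_univ_factor [Fintype V] [DecidableEq V] (v : V) (x : TIdx dim)
    (a : Fin (dim v)) :
    partialProduct ψ Set.univ x * ψ v a =
      partialProduct ψ Set.univ (Function.update x v a) * ψ v (x v) := by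
  simp only [partialProduct, Set.mem_univ, Finset.filter_true]
  rw [← Finset.mul_prod_erase _ _ (Finset.mem_univ v),
    ← Finset.mul_prod_erase _ (fun w => ψ w (Function.update x v a w)) (Finset.mem_univ v),
    Function.update_self]
  have : ∏ w ∈ Finset.univ.erase v, ψ w (Function.update x v a w) =
      ∏ w ∈ Finset.univ.erase v, ψ w (x w) :=
    Finset.prod_congr rfl fun w hw => by rw [Function.update_of_ne (Finset.ne_of_mem_erase hw)]
  rw [this]
  ring

theorem eq_of_mul_eq_mul_of_dependsOn {J : Set V} {g F F' : TIdx dim → ℂ} {x₀ : TIdx dim}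
    (hg : DependsOn g J) (hx₀ : g x₀ ≠ 0) (hF : DependsOn F Jᶜ) (hF' : DependsOn F' Jᶜ)
    (h : g * F = g * F') : F = F' := by
  funext x
  have h1 := congrFun h (J.piecewise x₀ x)
  simp only [Pi.mul_apply] at h1
  rw [hg (y := x₀) fun v hv => by simp [hv], hF (y := x) fun v hv => by simp [show v ∉ J from hv],
    hF' (y := x) fun v hv => by simp [show v ∉ J from hv]] at h1
  exact mul_left_cancel₀ hx₀ h1

/-- A factor on `I ∪ J` of a vector splits as a product of functions of the coordinates
in `I` and `J` as soon as the vector factors in a second way that separates `I` from `J`. -/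
theorem exists_eq_smul_mul {I J : Set V} {χ F Z F' Z' : TIdx dim → ℂ}
    {x₀ : TIdx dim} (hx₀ : χ x₀ ≠ 0) (h : χ = F * Z) (hF : DependsOn F (I ∪ J))
    (hZ : DependsOn Z (I ∪ J)ᶜ) (h' : χ = F' * Z') (hF' : DependsOn F' Iᶜ)
    (hZ' : DependsOn Z' Jᶜ) :
    ∃ r : ℂ, r ≠ 0 ∧
      F = r • (slice I χ x₀ * slice J χ x₀) := by
  have hZ0 : Z x₀ ≠ 0 := fun h0 => hx₀ (by rw [h]; simp [h0])
  refine ⟨(Z x₀ * χ x₀)⁻¹, inv_ne_zero (mul_ne_zero hZ0 hx₀), funext fun x => ?_⟩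
  simp only [Pi.smul_apply, Pi.mul_apply, smul_eq_mul, slice]
  have h1 : χ ((I ∪ J).piecewise x x₀) = F x * Z x₀ := by
    rw [h, Pi.mul_apply, hF (y := x) fun v hv => Set.piecewise_eq_of_mem _ _ _ hv,
      hZ (y := x₀) fun v hv => Set.piecewise_eq_of_notMem _ _ _ hv]
  have h2 : χ ((I ∪ J).piecewise x x₀) * χ x₀ =
      χ (I.piecewise x x₀) * χ (J.piecewise x x₀) := by
    rw [h']
    simp only [Pi.mul_apply]
    rw [hF' (x := (I ∪ J).piecewise x x₀) (y := J.piecewise x x₀) fun v hv => by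
        simp [Set.piecewise, show v ∉ I from hv],
      hF' (x := I.piecewise x x₀) (y := x₀) fun v hv => by
        simp [Set.piecewise, show v ∉ I from hv],
      hZ' (x := (I ∪ J).piecewise x x₀) (y := I.piecewise x x₀) fun v hv => by
        simp [Set.piecewise, show v ∉ J from hv],
      hZ' (x := J.piecewise x x₀) (y := x₀) fun v hv => by
        simp [Set.piecewise, show v ∉ J from hv]]
    ring
  rw [← h2, h1]
  field_simp

theorem dependsOn_slice (I : Set V) (χ : TIdx dim → ℂ) (x₀ : TIdx dim) :
    DependsOn (slice I χ x₀) I := fun x y hxy => by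
  refine congrArg χ (funext fun v => ?_)
  by_cases hv : v ∈ I <;> simp [hv, hxy]

theorem IsLocal.apply_mul_mul [DecidableEq V] {N J : Set V} {M : Module.End ℂ (TIdx dim → ℂ)}
    (hM : IsLocal N M) (hNJ : Disjoint N J) {f g h : TIdx dim → ℂ} (hg : DependsOn g J) :
    M (f * g * h) = g * M (f * h) := by
  rw [mul_comm f, mul_assoc]
  exact hM.1 _ _ (hg.mono_set fun v hJ hN => Set.disjoint_left.1 hNJ hN hJ)

theorem IsLocal.dependsOn_apply_mul [Fintype V] [DecidableEq V] {N I J : Set V}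
    {M : Module.End ℂ (TIdx dim → ℂ)} (hM : IsLocal N M) (hNJ : Disjoint N J)
    (hIJ : Disjoint I J) {f : TIdx dim → ℂ} (hf : DependsOn f I) :
    DependsOn (M (f * partialProduct ψ (I ∪ J)ᶜ)) Jᶜ := by
  refine hM.dependsOn (DependsOn.mul (hf.mono_set fun v hI hJ => Set.disjoint_left.1 hIJ hI hJ)
    ((partialProduct_dependsOn _).mono_set fun v hv hJ => hv (Or.inr hJ))) ?_
  exact fun v hN hJ => Set.disjoint_left.1 hNJ hN hJ

theorem IsLocal.apply_mul_partialProduct_compl [Fintype V] [DecidableEq V] {N I J : Set V}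
    {M : Module.End ℂ (TIdx dim → ℂ)} (hM : IsLocal N M) (hNJ : Disjoint N J)
    (hIJ : Disjoint I J) (f : TIdx dim → ℂ) :
    M (f * partialProduct ψ Iᶜ) = partialProduct ψ J * M (f * partialProduct ψ (I ∪ J)ᶜ) := by
  rw [← partialProduct_mul_of_disjoint hIJ, ← mul_assoc,
    hM.apply_mul_mul hNJ (partialProduct_dependsOn J)]

/-- A common factor `g` on `J` may be traded for the reference factor on `J`. -/
theorem trade_factor [Fintype V] [DecidableEq V] {N N' I J K : Set V}
    {M M' : Module.End ℂ (TIdx dim → ℂ)} (hM : IsLocal N M) (hM' : IsLocal N' M')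
    (hNJ : Disjoint N J) (hNJ' : Disjoint N' J)
    (hIJ : Disjoint I J) (hKJ : Disjoint K J) {f g h : TIdx dim → ℂ} (hf : DependsOn f I)
    (hg : DependsOn g J) (hh : DependsOn h K) {x₀ : TIdx dim} (hx₀ : g x₀ ≠ 0) {s t : ℂ}
    (heq : s • M (f * g * partialProduct ψ (I ∪ J)ᶜ) =
      t • M' (h * g * partialProduct ψ (K ∪ J)ᶜ)) :
    s • M (f * partialProduct ψ Iᶜ) = t • M' (h * partialProduct ψ Kᶜ) := by
  rw [hM.apply_mul_mul hNJ hg, hM'.apply_mul_mul hNJ' hg, ← mul_smul_comm,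
    ← mul_smul_comm] at heq
  have hd : ∀ (r : ℂ) {F : TIdx dim → ℂ}, DependsOn F Jᶜ → DependsOn (r • F) Jᶜ :=
    fun r F hF x y hxy => by simp only [Pi.smul_apply]; rw [hF hxy]
  have := eq_of_mul_eq_mul_of_dependsOn hg hx₀ (hd s (hM.dependsOn_apply_mul hNJ hIJ hf))
    (hd t (hM'.dependsOn_apply_mul hNJ' hKJ hh)) heq
  rw [hM.apply_mul_partialProduct_compl hNJ hIJ, hM'.apply_mul_partialProduct_compl hNJ' hKJ,
    ← mul_smul_comm, ← mul_smul_comm, this]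

theorem exists_factor_of_two_localizations [Fintype V] [DecidableEq V] {y : TIdx dim}
    (hy : ∀ v, ψ v (y v) ≠ 0) {I J R : Set V} {a b r : Module.End ℂ (TIdx dim → ℂ)}
    (ha : IsLocal I a) (hb : IsLocal J b) (hr : IsLocal R r)
    (h : a (b (partialProduct ψ Set.univ)) = r (partialProduct ψ Set.univ)) :
    ∃ F, DependsOn F (R ∩ I ∪ R ∩ J) ∧
      a (b (partialProduct ψ Set.univ)) = F * partialProduct ψ (R ∩ I ∪ R ∩ J)ᶜ := by
  refine exists_mul_partialProduct hy fun v hv => ?_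
  by_cases hR : v ∈ R
  · exact ha.factor (fun hI => hv (Or.inl ⟨hR, hI⟩))
      (hb.factor (fun hJ => hv (Or.inr ⟨hR, hJ⟩)) (partialProduct_univ_factor v))
  · rw [h]
    exact hr.factor hR (partialProduct_univ_factor v)

/-- Three strings emanating from a common site, pairwise anticommuting on a product state and
pairwise deformable to operators localized far from that site, cannot exist. -/
theorem no_fermionic_junction_of_product [Fintype V] [DecidableEq V] {y : TIdx dim}
    (hy : ∀ v, ψ v (y v) ≠ 0)
    {NI NJ NK R : Set V} (hRIJ : ∀ v ∈ R, v ∈ NI → v ∉ NJ) (hRIK : ∀ v ∈ R, v ∈ NI → v ∉ NK)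
    (hRJK : ∀ v ∈ R, v ∈ NJ → v ∉ NK)
    {a b c a' b' c' rab rbc rac : Module.End ℂ (TIdx dim → ℂ)}
    (ha : IsLocal NI a) (hb : IsLocal NJ b) (hc : IsLocal NK c)
    (ha' : IsLocal NI a') (hb' : IsLocal NJ b') (hc' : IsLocal NK c')
    (hrab : IsLocal R rab) (hrbc : IsLocal R rbc) (hrac : IsLocal R rac)
    {P : TIdx dim → ℂ} (hP : P = partialProduct ψ Set.univ)
    (hab : a (b P) = rab P) (hbc : b (c P) = rbc P) (hac : a (c P) = rac P)
    (hba : b (a P) = -a (b P)) (hca : c (a P) = -a (c P)) (hcb : c (b P) = -b (c P))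
    (hcab : c (a (b P)) = a (b (c P))) (hbac : b (a (c P)) = -a (b (c P)))
    (iab : a' (a (b P)) = b P) (iac : a' (a (c P)) = c P) (iba : b' (b (a P)) = a P)
    (ibc : b' (b (c P)) = c P) (ica : c' (c (a P)) = a P) (icb : c' (c (b P)) = b P)
    (hne : a (b (c P)) ≠ 0) : False := by
  subst hP
  obtain ⟨F, hFd, hF⟩ := exists_factor_of_two_localizations hy ha hb hrab hab
  obtain ⟨F', hFd', hF'⟩ := exists_factor_of_two_localizations hy hb hc hrbc hbc
  obtain ⟨F'', hFd'', hF''⟩ := exists_factor_of_two_localizations hy ha hc hrac hac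
  set P := partialProduct ψ Set.univ with hP
  set I := R ∩ NI with hI
  set J := R ∩ NJ with hJ
  set K := R ∩ NK with hK
  have dIJ' : Disjoint NI J := Set.disjoint_left.2 fun v h h' => hRIJ v h'.1 h h'.2
  have dIK' : Disjoint NI K := Set.disjoint_left.2 fun v h h' => hRIK v h'.1 h h'.2
  have dJI' : Disjoint NJ I := Set.disjoint_left.2 fun v h h' => hRIJ v h'.1 h'.2 h
  have dJK' : Disjoint NJ K := Set.disjoint_left.2 fun v h h' => hRJK v h'.1 h h'.2
  have dKI' : Disjoint NK I := Set.disjoint_left.2 fun v h h' => hRIK v h'.1 h'.2 h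
  have dKJ' : Disjoint NK J := Set.disjoint_left.2 fun v h h' => hRJK v h'.1 h'.2 h
  have dIJ : Disjoint I J := dIJ'.mono_left Set.inter_subset_right
  have dIK : Disjoint I K := dIK'.mono_left Set.inter_subset_right
  have dJK : Disjoint J K := dJK'.mono_left Set.inter_subset_right
  obtain ⟨x₀, hx₀⟩ := Function.ne_iff.1 hne
  set χ := a (b (c P)) with hχ
  have hfac : ∀ {N X Y : Set V} {M : Module.End ℂ (TIdx dim → ℂ)} {F : TIdx dim → ℂ},
      IsLocal N M → Disjoint N X → Disjoint N Y → DependsOn F (X ∪ Y) →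
      M (F * partialProduct ψ (X ∪ Y)ᶜ) = F * M (partialProduct ψ (X ∪ Y)ᶜ) ∧
        DependsOn (M (partialProduct ψ (X ∪ Y)ᶜ)) (X ∪ Y)ᶜ := by
    intro N X Y M F hM hX hY hF
    have hsub : N ⊆ (X ∪ Y)ᶜ := fun v hN hXY =>
      hXY.elim (Set.disjoint_left.1 hX hN) (Set.disjoint_left.1 hY hN)
    exact ⟨hM.1 _ _ (hF.mono_set fun v hv hN => hsub hN hv),
      hM.dependsOn (partialProduct_dependsOn _) hsub⟩
  have e1 := hfac hc dKI' dKJ' hFd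
  have e2 := hfac ha dIJ' dIK' hFd'
  rw [← hF, hcab] at e1
  rw [← hF'] at e2
  have sub : ∀ {X Y Z : Set V}, Disjoint Z X → Disjoint Z Y → X ∪ Y ⊆ Zᶜ :=
    fun hX hY v hv hZ => hv.elim (Set.disjoint_left.1 hX hZ) (Set.disjoint_left.1 hY hZ)
  have subl : ∀ X Y : Set V, (X ∪ Y)ᶜ ⊆ Xᶜ :=
    fun _ _ => Set.compl_subset_compl.2 Set.subset_union_left
  have subr : ∀ X Y : Set V, (X ∪ Y)ᶜ ⊆ Yᶜ :=
    fun _ _ => Set.compl_subset_compl.2 Set.subset_union_right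
  have e3 := hfac hb dJI' dJK' hFd''
  rw [← hF'', hbac] at e3
  have e3' : χ = F'' * (-b (partialProduct ψ (I ∪ K)ᶜ)) := by
    rw [mul_neg, ← e3.1, neg_neg]
  obtain ⟨p, hp, hFp⟩ := exists_eq_smul_mul hx₀ e1.1 hFd e1.2 e2.1
    (hFd'.mono_set (sub dIJ dIK)) (e2.2.mono_set (subl _ _))
  obtain ⟨q, hq, hFq⟩ := exists_eq_smul_mul hx₀ e2.1 hFd' e2.2 e3'
    (hFd''.mono_set (sub dIJ.symm dJK))
    (fun x y hxy => by simp only [Pi.neg_apply]; rw [e3.2.mono_set (subr _ _) hxy])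
  obtain ⟨r, hr, hFr⟩ := exists_eq_smul_mul hx₀ e3' hFd''
    (fun x y hxy => by simp only [Pi.neg_apply]; rw [e3.2 hxy]) e2.1
    (hFd'.mono_set (sub dIJ dIK)) (e2.2.mono_set (subr _ _))
  have hdep := fun X => dependsOn_slice X χ x₀
  have hself : ∀ X : Set V, slice X χ x₀ x₀ ≠ 0 := fun X => by simpa [slice] using hx₀
  set f := slice I χ x₀
  set g := slice J χ x₀
  set h := slice K χ x₀
  rw [hFp, smul_mul_assoc] at hF
  rw [hFq, smul_mul_assoc] at hF'
  rw [hFr, smul_mul_assoc] at hF''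
  have t1 : p • a' (f * partialProduct ψ Iᶜ) = (-q) • c' (h * partialProduct ψ Kᶜ) := by
    refine trade_factor ha' hc' dIJ' dKJ' dIJ dJK.symm (hdep I) (hdep J) (hdep K) (hself J) ?_
    rw [← map_smul, ← hF, iab, neg_smul, ← map_smul, Set.union_comm K,
      mul_comm h, ← hF', ← map_neg, ← hcb, icb]
  have t2 : (-p) • b' (g * partialProduct ψ Jᶜ) = (-r) • c' (h * partialProduct ψ Kᶜ) := by
    refine trade_factor hb' hc' dJI' dKI' dIJ.symm dIK.symm (hdep J) (hdep I) (hdep K)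
      (hself I) ?_
    rw [neg_smul, ← map_smul, Set.union_comm J, mul_comm g, ← hF, ← map_neg, ← hba, iba,
      neg_smul, ← map_smul, Set.union_comm K, mul_comm h, ← hF'', ← map_neg, ← hca, ica]
  have t3 : q • b' (g * partialProduct ψ Jᶜ) = r • a' (f * partialProduct ψ Iᶜ) := by
    refine trade_factor hb' ha' dJK' dIK' dJK dIK (hdep J) (hdep K) (hdep I)
      (hself K) ?_
    rw [← map_smul, ← hF', ibc, ← map_smul, ← hF'', iac]
  have hΘ : a' (f * partialProduct ψ Iᶜ) ≠ 0 := by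
    intro h0
    rw [ha'.apply_mul_partialProduct_compl dIJ' dIJ] at h0
    have h1 := eq_of_mul_eq_mul_of_dependsOn (F' := 0) (partialProduct_dependsOn J)
      (partialProduct_ne_zero hy J) (ha'.dependsOn_apply_mul dIJ' dIJ (hdep I))
      (fun _ _ _ => rfl) (by rw [h0, mul_zero])
    have h2 : b P = 0 := by
      rw [← iab, hF, map_smul, ha'.apply_mul_mul dIJ' (hdep J), h1, mul_zero, smul_zero]
    exact hne (by rw [← hcab, h2, map_zero, map_zero])
  generalize a' (f * partialProduct ψ Iᶜ) = A, b' (g * partialProduct ψ Jᶜ) = B,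
    c' (h * partialProduct ψ Kᶜ) = C at *
  obtain ⟨x, hx⟩ := Function.ne_iff.1 hΘ
  have t1 := congrFun t1 x
  have t2 := congrFun t2 x
  have t3 := congrFun t3 x
  simp only [Pi.smul_apply, smul_eq_mul] at t1 t2 t3
  have : 2 * p * r * A x = 0 := by linear_combination r * t1 - q * t2 - p * t3
  simp [hp, hr] at this
  exact hx this

end ProductStates

section LightCone

variable {V : Type*} [Fintype V] [DecidableEq V] {G : SimpleGraph V} {dim : V → ℕ}

theorem IsLocal.conj_gates {gs : List (Matrix (TIdx dim) (TIdx dim) ℂ × V × V)} :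
    (∀ g ∈ gs, IsGate G dim g) →
    gs.Pairwise (fun g g' => ({g.2.1, g.2.2} : Set V) ∩ {g'.2.1, g'.2.2} = ∅) →
    ∀ {S : Set V} {M : Matrix (TIdx dim) (TIdx dim) ℂ}, IsLocal S (Matrix.toLin' M) →
    IsLocal {x | x ∈ S ∨ ∃ g ∈ gs, (x = g.2.1 ∨ x = g.2.2) ∧ (g.2.1 ∈ S ∨ g.2.2 ∈ S)}
      (Matrix.toLin' (star (gs.map Prod.fst).prod * M * (gs.map Prod.fst).prod)) := by
  induction gs with
  | nil =>
    intro _ _ S M hM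
    simpa using hM
  | cons g gs ih =>
    intro hg hp S M hM
    obtain ⟨-, hunit, hsupp⟩ := hg g (by simp)
    rw [List.pairwise_cons] at hp
    have hstar : star g.1 * g.1 = 1 := Matrix.mem_unitaryGroup_iff'.1 hunit
    have hassoc : star ((g :: gs).map Prod.fst).prod * M * ((g :: gs).map Prod.fst).prod =
        star (gs.map Prod.fst).prod * (star g.1 * M * g.1) * (gs.map Prod.fst).prod := by
      simp only [List.map_cons, List.prod_cons, star_mul, mul_assoc]
    rw [hassoc]
    by_cases hS : g.2.1 ∈ S ∨ g.2.2 ∈ S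
    · have hloc : IsLocal (S ∪ {g.2.1, g.2.2}) (Matrix.toLin' (star g.1 * M * g.1)) := by
        simp only [Matrix.toLin'_mul, ← Module.End.mul_eq_comp]
        exact ((hsupp.conjTranspose.isLocal.mono Set.subset_union_right).mul
          (hM.mono Set.subset_union_left)).mul (hsupp.isLocal.mono Set.subset_union_right)
      refine (ih (fun g' h' => hg g' (by simp [h'])) hp.2 hloc).mono ?_
      rintro x ((hx | hx) | ⟨g', hg', hx, hxS⟩)
      · exact Or.inl hx
      · exact Or.inr ⟨g, by simp, by simpa using hx, hS⟩
      · have hdisj := hp.1 g' hg'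
        have h1 : ∀ v, v = g'.2.1 ∨ v = g'.2.2 → v ∈ S ∪ {g.2.1, g.2.2} → v ∈ S := by
          rintro v hv (hvS | hvg)
          · exact hvS
          · have hmem : v ∈ ({g.2.1, g.2.2} : Set V) ∩ {g'.2.1, g'.2.2} := ⟨hvg, hv⟩
            rw [hdisj] at hmem
            exact hmem.elim
        exact Or.inr ⟨g', by simp [hg'], hx,
          hxS.imp (h1 _ (Or.inl rfl)) (h1 _ (Or.inr rfl))⟩
    · have hcomm : M * g.1 = g.1 * M := by
        apply Matrix.toLin'.injective
        simp only [Matrix.toLin'_mul, ← Module.End.mul_eq_comp]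
        refine hM.commute hsupp.isLocal (Set.eq_empty_of_forall_notMem ?_)
        rintro v ⟨hv, rfl | rfl⟩
        · exact hS (Or.inl hv)
        · exact hS (Or.inr hv)
      rw [mul_assoc (star g.1), hcomm, ← mul_assoc (star g.1), hstar, one_mul]
      refine (ih (fun g' h' => hg g' (by simp [h'])) hp.2 hM).mono ?_
      rintro x (hx | ⟨g', hg', hx, hxS⟩)
      · exact Or.inl hx
      · exact Or.inr ⟨g', by simp [hg'], hx, hxS⟩

theorem IsLocal.conj_layer {L : Matrix (TIdx dim) (TIdx dim) ℂ} (hL : IsLayer G dim L) {S : Set V}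
    {M : Matrix (TIdx dim) (TIdx dim) ℂ} (hM : IsLocal S (Matrix.toLin' M)) :
    IsLocal {x | ∃ y ∈ S, G.dist x y ≤ 1} (Matrix.toLin' (star L * M * L)) := by
  obtain ⟨gs, hg, hp, rfl⟩ := hL
  refine (hM.conj_gates hg hp).mono ?_
  rintro x (hx | ⟨g, hgs, rfl | rfl, hS | hS⟩)
  · exact ⟨x, hx, by simp⟩
  · exact ⟨_, hS, by simp⟩
  · exact ⟨_, hS, (SimpleGraph.dist_eq_one_iff_adj.2 (hg g hgs).1).le⟩
  · exact ⟨_, hS, (SimpleGraph.dist_eq_one_iff_adj.2 (hg g hgs).1.symm).le⟩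
  · exact ⟨_, hS, by simp⟩

theorem IsLocal.conj_circuit (hG : G.Connected) {d : ℕ} {U : Matrix (TIdx dim) (TIdx dim) ℂ}
    (hU : IsCircuitOfDepthLE G dim d U) {S : Set V}
    {M : Matrix (TIdx dim) (TIdx dim) ℂ} (hM : IsLocal S (Matrix.toLin' M)) :
    IsLocal {x | ∃ y ∈ S, G.dist x y ≤ d} (Matrix.toLin' (star U * M * U)) := by
  obtain ⟨Ls, hd, hLs, rfl⟩ := hU
  suffices h : IsLocal {x | ∃ y ∈ S, G.dist x y ≤ Ls.length}
      (Matrix.toLin' (star Ls.prod * M * Ls.prod)) from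
    h.mono fun x ⟨y, hy, hxy⟩ => ⟨y, hy, hxy.trans hd⟩
  clear hd
  induction Ls generalizing S M with
  | nil => exact (by simpa using hM : IsLocal S _).mono fun x hx => ⟨x, hx, by simp⟩
  | cons L Ls ih =>
    have hassoc : star (L :: Ls).prod * M * (L :: Ls).prod =
        star Ls.prod * (star L * M * L) * Ls.prod := by
      simp only [List.prod_cons, star_mul, mul_assoc]
    rw [hassoc]
    refine (ih (hM.conj_layer (hLs L (by simp))) fun L' h' => hLs L' (by simp [h'])).mono ?_
    rintro x ⟨y, ⟨z, hz, hyz⟩, hxy⟩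
    refine ⟨z, hz, (hG.dist_triangle (v := y)).trans ?_⟩
    simp only [List.length_cons]
    omega

theorem IsCircuitOfDepthLE.mem_unitaryGroup {d : ℕ} {U : Matrix (TIdx dim) (TIdx dim) ℂ}
    (hU : IsCircuitOfDepthLE G dim d U) : U ∈ Matrix.unitaryGroup (TIdx dim) ℂ := by
  obtain ⟨Ls, -, hLs, rfl⟩ := hU
  refine Submonoid.list_prod_mem _ fun L hL => ?_
  obtain ⟨gs, hg, -, rfl⟩ := hLs L hL
  refine Submonoid.list_prod_mem _ fun M hM => ?_
  obtain ⟨g, hgs, rfl⟩ := List.mem_map.1 hM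
  exact (hg g hgs).2.1

end LightCone

/-- The ordered product of `X (f t) (f (t + 1))` for `t < n`. -/
def pathProd {V R : Type*} [Monoid R] (X : V → V → R) (f : ℕ → V) : ℕ → R
  | 0 => 1
  | n + 1 => pathProd X f n * X (f n) (f (n + 1))

/-- The product of `X (f t) (f (t + 1))` for `t < n`, in the reverse order. -/
def revPathProd {V R : Type*} [Monoid R] (X : V → V → R) (f : ℕ → V) : ℕ → R
  | 0 => 1
  | n + 1 => X (f n) (f (n + 1)) * revPathProd X f n

section PathProducts

variable {V R : Type*} [Monoid R] {X : V → V → R}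

theorem pathProd_add (f : ℕ → V) (p q : ℕ) :
    pathProd X f (p + q) = pathProd X f p * pathProd X (fun t => f (p + t)) q := by
  induction q with
  | zero => simp [pathProd]
  | succ q ih => rw [← add_assoc, pathProd, ih, pathProd, mul_assoc]; rfl

theorem revPathProd_add (f : ℕ → V) (p q : ℕ) :
    revPathProd X f (p + q) = revPathProd X (fun t => f (p + t)) q * revPathProd X f p := by
  induction q with
  | zero => simp [revPathProd]
  | succ q ih => rw [← add_assoc, revPathProd, ih, revPathProd, mul_assoc]; rfl

theorem pathProd_congr {f g : ℕ → V} {n : ℕ} (h : ∀ t ≤ n, f t = g t) :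
    pathProd X f n = pathProd X g n := by
  induction n with
  | zero => rfl
  | succ n ih => rw [pathProd, pathProd, ih fun t ht => h t (by omega), h n (by omega),
      h (n + 1) le_rfl]

theorem prod_ofFn_eq_pathProd (f : ℕ → V) (n : ℕ) :
    (List.ofFn fun t : Fin n => X (f t) (f (t + 1))).prod = pathProd X f n := by
  induction n with
  | zero => simp [pathProd]
  | succ n ih => rw [List.ofFn_succ', List.concat_eq_append, List.prod_append, pathProd, ← ih]; simp

theorem pathProd_induction {p : R → Prop} (h1 : p 1) (hmul : ∀ a b, p a → p b → p (a * b))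
    {f : ℕ → V} {n : ℕ} (h : ∀ t < n, p (X (f t) (f (t + 1)))) : p (pathProd X f n) := by
  induction n with
  | zero => exact h1
  | succ n ih => exact hmul _ _ (ih fun t ht => h t (by omega)) (h n (by omega))

theorem revPathProd_induction {p : R → Prop} (h1 : p 1) (hmul : ∀ a b, p a → p b → p (a * b))
    {f : ℕ → V} {n : ℕ} (h : ∀ t < n, p (X (f t) (f (t + 1)))) : p (revPathProd X f n) := by
  induction n with
  | zero => exact h1
  | succ n ih => exact hmul _ _ (h n (by omega)) (ih fun t ht => h t (by omega))

theorem revPathProd_mul_pathProd {f : ℕ → V} {n : ℕ}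
    (h : ∀ t < n, X (f t) (f (t + 1)) * X (f t) (f (t + 1)) = 1) :
    revPathProd X f n * pathProd X f n = 1 ∧ pathProd X f n * revPathProd X f n = 1 := by
  induction n with
  | zero => simp [pathProd, revPathProd]
  | succ n ih =>
    obtain ⟨h1, h2⟩ := ih fun t ht => h t (by omega)
    have h0 := h n (by omega)
    constructor
    · rw [revPathProd, pathProd, mul_assoc, ← mul_assoc (revPathProd X f n), h1, one_mul, h0]
    · rw [revPathProd, pathProd, mul_assoc, ← mul_assoc (X _ _) (X _ _), h0, one_mul, h2]

end PathProducts

section SignedCommutation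

variable {V R : Type*} [Ring R] [Algebra ℂ R] {G : SimpleGraph V} {X : V → V → R}

theorem neg_one_pow_kdelta_mul_self [DecidableEq V] (a b : V) :
    (-1 : ℂ) ^ kdelta a b * (-1 : ℂ) ^ kdelta a b = 1 := by
  rw [← mul_pow]
  simp

theorem edge_mul_pathProd [DecidableEq V]
    (hcomm : ∀ j k l m, G.Adj j k → G.Adj l m → X j k * X l m =
      ((-1 : ℂ) ^ (kdelta j l + kdelta k l + kdelta j m + kdelta k m)) • (X l m * X j k))
    {x y : V} (hxy : G.Adj x y) {f : ℕ → V} {n : ℕ} (hf : ∀ t < n, G.Adj (f t) (f (t + 1))) :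
    X x y * pathProd X f n = ((-1 : ℂ) ^ kdelta x (f 0) * (-1 : ℂ) ^ kdelta y (f 0) *
      (-1 : ℂ) ^ kdelta x (f n) * (-1 : ℂ) ^ kdelta y (f n)) • (pathProd X f n * X x y) := by
  induction n with
  | zero =>
    rw [show ∀ a b : ℂ, a * b * a * b = (a * a) * (b * b) by intros; ring,
      neg_one_pow_kdelta_mul_self, neg_one_pow_kdelta_mul_self]
    simp [pathProd]
  | succ n ih =>
    have h1 := neg_one_pow_kdelta_mul_self x (f n)
    have h2 := neg_one_pow_kdelta_mul_self y (f n)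
    rw [pathProd, ← mul_assoc, ih fun t ht => hf t (by omega), smul_mul_assoc,
      mul_assoc (pathProd X f n), hcomm x y _ _ hxy (hf n (by omega)), mul_smul_comm, smul_smul,
      mul_assoc (pathProd X f n)]
    congr 1
    simp only [pow_add]
    generalize (-1 : ℂ) ^ kdelta x (f n) = p at *
    generalize (-1 : ℂ) ^ kdelta y (f n) = q at *
    linear_combination (-1 : ℂ) ^ kdelta x (f 0) * (-1 : ℂ) ^ kdelta y (f 0) *
      (-1 : ℂ) ^ kdelta x (f (n + 1)) * (-1 : ℂ) ^ kdelta y (f (n + 1)) * (q * q * h1 + h2)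

theorem pathProd_mul_pathProd [DecidableEq V]
    (hcomm : ∀ j k l m, G.Adj j k → G.Adj l m → X j k * X l m =
      ((-1 : ℂ) ^ (kdelta j l + kdelta k l + kdelta j m + kdelta k m)) • (X l m * X j k))
    {f g : ℕ → V} {n m : ℕ} (hf : ∀ t < n, G.Adj (f t) (f (t + 1)))
    (hg : ∀ t < m, G.Adj (g t) (g (t + 1))) :
    pathProd X f n * pathProd X g m =
      ((-1 : ℂ) ^ kdelta (f 0) (g 0) * (-1 : ℂ) ^ kdelta (f 0) (g m) *
      (-1 : ℂ) ^ kdelta (f n) (g 0) * (-1 : ℂ) ^ kdelta (f n) (g m)) •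
        (pathProd X g m * pathProd X f n) := by
  induction n with
  | zero =>
    rw [show ∀ a b : ℂ, a * b * a * b = (a * a) * (b * b) by intros; ring,
      neg_one_pow_kdelta_mul_self, neg_one_pow_kdelta_mul_self]
    simp [pathProd]
  | succ n ih =>
    have h1 := neg_one_pow_kdelta_mul_self (f n) (g 0)
    have h2 := neg_one_pow_kdelta_mul_self (f n) (g m)
    rw [pathProd, mul_assoc, edge_mul_pathProd hcomm (hf n (by omega)) hg, mul_smul_comm,
      ← mul_assoc, ih fun t ht => hf t (by omega), smul_mul_assoc, smul_smul,
      mul_assoc (pathProd X g m)]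
    congr 1
    generalize (-1 : ℂ) ^ kdelta (f n) (g 0) = p at *
    generalize (-1 : ℂ) ^ kdelta (f n) (g m) = q at *
    linear_combination (-1 : ℂ) ^ kdelta (f 0) (g 0) * (-1 : ℂ) ^ kdelta (f 0) (g m) *
      (-1 : ℂ) ^ kdelta (f (n + 1)) (g 0) * (-1 : ℂ) ^ kdelta (f (n + 1)) (g m) *
      (q * q * h1 + h2)

theorem pathProd_anticomm [DecidableEq V]
    (hcomm : ∀ j k l m, G.Adj j k → G.Adj l m → X j k * X l m =
      ((-1 : ℂ) ^ (kdelta j l + kdelta k l + kdelta j m + kdelta k m)) • (X l m * X j k))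
    {f g : ℕ → V} {n m : ℕ} (hf : ∀ t < n, G.Adj (f t) (f (t + 1)))
    (hg : ∀ t < m, G.Adj (g t) (g (t + 1))) (h00 : f 0 = g 0) (h0m : f 0 ≠ g m)
    (hn0 : f n ≠ g 0) (hnm : f n ≠ g m) :
    pathProd X g m * pathProd X f n = -(pathProd X f n * pathProd X g m) := by
  rw [pathProd_mul_pathProd hcomm hf hg]
  simp [kdelta, h00, h00 ▸ h0m, hn0, hnm]

theorem exists_revPathProd_eq_smul [DecidableEq V]
    (hcomm : ∀ j k l m, G.Adj j k → G.Adj l m → X j k * X l m =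
      ((-1 : ℂ) ^ (kdelta j l + kdelta k l + kdelta j m + kdelta k m)) • (X l m * X j k))
    {f : ℕ → V} {n : ℕ} (hf : ∀ t < n, G.Adj (f t) (f (t + 1))) :
    ∃ r : ℂ, r ≠ 0 ∧ revPathProd X f n = r • pathProd X f n := by
  induction n with
  | zero => exact ⟨1, one_ne_zero, by simp [pathProd, revPathProd]⟩
  | succ n ih =>
    obtain ⟨r, hr, h⟩ := ih fun t ht => hf t (by omega)
    refine ⟨_, ?_, by rw [revPathProd, h, mul_smul_comm, edge_mul_pathProd hcomm (hf n (by omega))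
      fun t ht => hf t (by omega), smul_smul, pathProd]⟩
    simp [hr]

theorem pathProd_reverse (hanti : ∀ j k, G.Adj j k → X k j = -X j k) {f : ℕ → V} {m : ℕ}
    (hf : ∀ t < m, G.Adj (f t) (f (t + 1))) :
    pathProd X (fun t => f (m - t)) m = ((-1 : ℂ) ^ m) • revPathProd X f m := by
  induction m with
  | zero => simp [pathProd, revPathProd]
  | succ m ih =>
    have h := pathProd_add (X := X) (fun t => f (m + 1 - t)) 1 m
    have htail : pathProd X (fun t => f (m + 1 - (1 + t))) m = pathProd X (fun t => f (m - t)) m :=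
      pathProd_congr fun t _ => by congr 1; omega
    rw [add_comm 1 m, htail, ih fun t ht => hf t (by omega)] at h
    rw [h]
    simp only [pathProd, revPathProd, one_mul, Nat.sub_zero, zero_add, Nat.add_sub_cancel]
    rw [hanti _ _ (hf m (by omega)), pow_succ, mul_smul_comm, mul_smul]
    simp

theorem exists_smul_loop_eq_one (hanti : ∀ j k, G.Adj j k → X k j = -X j k)
    (hloop : ∀ (N : ℕ) (f : ℕ → V), (∀ t < N + 1, G.Adj (f t) (f (t + 1))) → f (N + 1) = f 0 →
      Complex.I ^ (N + 1) • pathProd X f (N + 1) = 1)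
    {f g : ℕ → V} {n m : ℕ} (hf : ∀ t < n, G.Adj (f t) (f (t + 1)))
    (hg : ∀ t < m, G.Adj (g t) (g (t + 1))) (h0 : f 0 = g 0) (hnm : f n = g m) (hn : 0 < n) :
    ∃ r : ℂ, r • (pathProd X f n * revPathProd X g m) = 1 := by
  obtain ⟨N, hN⟩ : ∃ N, n + m = N + 1 := ⟨n + m - 1, by omega⟩
  let F : ℕ → V := fun t => if t ≤ n then f t else g (n + m - t)
  have hF1 : ∀ t ≤ n, F t = f t := fun t ht => if_pos ht
  have hF2 : ∀ t ≤ m, F (n + t) = g (m - t) := by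
    intro t ht
    rcases Nat.eq_zero_or_pos t with rfl | hpos
    · rw [add_zero, hF1 n le_rfl, hnm, Nat.sub_zero]
    · simp only [F]
      rw [if_neg (by omega)]
      congr 1
      omega
  have hadj : ∀ t < N + 1, G.Adj (F t) (F (t + 1)) := by
    intro t ht
    rcases lt_or_ge t n with h | h
    · rw [hF1 t h.le, hF1 (t + 1) h]
      exact hf t h
    · obtain ⟨s, rfl⟩ := Nat.exists_eq_add_of_le h
      rw [hF2 s (by omega), add_assoc, hF2 (s + 1) (by omega)]
      have := hg (m - (s + 1)) (by omega)
      rw [show m - (s + 1) + 1 = m - s by omega] at this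
      exact this.symm
  have key := hloop N F hadj (by
    rw [← hN, hF2 m le_rfl, hF1 0 (Nat.zero_le _), Nat.sub_self, h0])
  rw [← hN, pathProd_add, pathProd_congr hF1, pathProd_congr hF2, pathProd_reverse hanti hg,
    mul_smul_comm, smul_smul] at key
  exact ⟨_, key⟩

/-- The product of the initial segments of two paths with common end points equals, up to a scalar,
the product of the remaining segments. -/
theorem exists_pathProd_mul_eq_smul [DecidableEq V]
    (hcomm : ∀ j k l m, G.Adj j k → G.Adj l m → X j k * X l m =
      ((-1 : ℂ) ^ (kdelta j l + kdelta k l + kdelta j m + kdelta k m)) • (X l m * X j k))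
    (hsq : ∀ j k, G.Adj j k → X j k * X j k = 1)
    (hanti : ∀ j k, G.Adj j k → X k j = -X j k)
    (hloop : ∀ (N : ℕ) (f : ℕ → V), (∀ t < N + 1, G.Adj (f t) (f (t + 1))) → f (N + 1) = f 0 →
      Complex.I ^ (N + 1) • pathProd X f (N + 1) = 1)
    {f g : ℕ → V} {n m D : ℕ} (hf : ∀ t < n, G.Adj (f t) (f (t + 1)))
    (hg : ∀ t < m, G.Adj (g t) (g (t + 1))) (h0 : f 0 = g 0) (hnm : f n = g m) (hn : D < n)
    (hm : D < m) :
    ∃ r : ℂ, pathProd X f D * pathProd X g D =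
      r • (pathProd X (fun t => f (D + t)) (n - D) *
        revPathProd X (fun t => g (D + t)) (m - D)) := by
  obtain ⟨r, hr⟩ := exists_smul_loop_eq_one hanti hloop hf hg h0 hnm (by omega)
  obtain ⟨p, rfl⟩ := Nat.exists_eq_add_of_le hn.le
  obtain ⟨q, rfl⟩ := Nat.exists_eq_add_of_le hm.le
  rw [Nat.add_sub_cancel_left, Nat.add_sub_cancel_left]
  rw [pathProd_add, revPathProd_add] at hr
  obtain ⟨s, hs, hrev⟩ := exists_revPathProd_eq_smul hcomm (f := f) (n := D)
    fun t ht => hf t (by omega)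
  have ef := (revPathProd_mul_pathProd (X := X) (f := f) (n := D)
    fun t ht => hsq _ _ (hf t (by omega))).1
  have eg := (revPathProd_mul_pathProd (X := X) (f := g) (n := D)
    fun t ht => hsq _ _ (hg t (by omega))).1
  generalize pathProd X (fun t => f (D + t)) p = a' at *
  generalize revPathProd X (fun t => g (D + t)) q = b' at *
  have h1 : revPathProd X f D * (r • (pathProd X f D * a' * (b' * revPathProd X g D))) *
      pathProd X g D = r • (a' * b') := by
    rw [mul_smul_comm, smul_mul_assoc]
    congr 1
    calc _ = (revPathProd X f D * pathProd X f D) * a' * b' *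
        (revPathProd X g D * pathProd X g D) := by simp only [mul_assoc]
      _ = _ := by rw [ef, eg, one_mul, mul_one]
  rw [hr, mul_one, hrev, smul_mul_assoc] at h1
  exact ⟨s⁻¹ * r, by rw [mul_smul, ← h1, inv_smul_smul₀ hs]⟩

end SignedCommutation

section Encoding

variable {V : Type*} {dim : V → ℕ} {C : Submodule ℂ (TIdx dim → ℂ)}

/-- The endomorphism `x` of the subspace `C` is the restriction of the matrix `M`. -/
def Restricts [Fintype V] [DecidableEq V] (M : Matrix (TIdx dim) (TIdx dim) ℂ)
    (x : Module.End ℂ C) : Prop :=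
  ∀ φ : C, (x φ : TIdx dim → ℂ) = M.mulVec φ

theorem Restricts.one [Fintype V] [DecidableEq V] :
    Restricts (C := C) (1 : Matrix (TIdx dim) (TIdx dim) ℂ) 1 := fun φ => by simp

theorem Restricts.mul [Fintype V] [DecidableEq V] {M N : Matrix (TIdx dim) (TIdx dim) ℂ}
    {x y : Module.End ℂ C}
    (hM : Restricts M x) (hN : Restricts N y) : Restricts (M * N) (x * y) := fun φ => by
  rw [Module.End.mul_apply, hM, hN, Matrix.mulVec_mulVec]

theorem Restricts.smul [Fintype V] [DecidableEq V] {M : Matrix (TIdx dim) (TIdx dim) ℂ}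
    {x : Module.End ℂ C}
    (r : ℂ) (hM : Restricts M x) : Restricts (r • M) (r • x) := fun φ => by
  rw [LinearMap.smul_apply, Submodule.coe_smul, hM, Matrix.smul_mulVec]

theorem Restricts.pathProd [Fintype V] [DecidableEq V]
    {A : V → V → Matrix (TIdx dim) (TIdx dim) ℂ} {X : V → V → Module.End ℂ C} {f : ℕ → V} {n : ℕ}
    (h : ∀ t < n, Restricts (A (f t) (f (t + 1))) (X (f t) (f (t + 1)))) :
    Restricts (pathProd A f n) (pathProd X f n) := by
  induction n with
  | zero => exact .one
  | succ n ih => exact (ih fun t ht => h t (by omega)).mul (h n (by omega))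

theorem Restricts.revPathProd [Fintype V] [DecidableEq V]
    {A : V → V → Matrix (TIdx dim) (TIdx dim) ℂ} {X : V → V → Module.End ℂ C} {f : ℕ → V} {n : ℕ}
    (h : ∀ t < n, Restricts (A (f t) (f (t + 1))) (X (f t) (f (t + 1)))) :
    Restricts (revPathProd A f n) (revPathProd X f n) := by
  induction n with
  | zero => exact .one
  | succ n ih => exact (h n (by omega)).mul (ih fun t ht => h t (by omega))

/-- The edge operators of a local block encoding restrict to operators on the code space that
satisfy the fermionic relations exactly. -/
theorem IsLocalBlockEncoding.exists_restrict [Fintype V] [DecidableEq V] {G : SimpleGraph V}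
    {A : V → V → Matrix (TIdx dim) (TIdx dim) ℂ} {B : V → Matrix (TIdx dim) (TIdx dim) ℂ}
    (h : IsLocalBlockEncoding G dim A B C) :
    ∃ X : V → V → Module.End ℂ C, (∀ j k, G.Adj j k → Restricts (A j k) (X j k)) ∧
      (∀ j k l m, G.Adj j k → G.Adj l m → X j k * X l m =
        ((-1 : ℂ) ^ (kdelta j l + kdelta k l + kdelta j m + kdelta k m)) • (X l m * X j k)) ∧
      (∀ j k, G.Adj j k → X j k * X j k = 1) ∧
      (∀ j k, G.Adj j k → X k j = -X j k) ∧
      (∀ (N : ℕ) (f : ℕ → V), (∀ t < N + 1, G.Adj (f t) (f (t + 1))) → f (N + 1) = f 0 →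
        Complex.I ^ (N + 1) • _root_.pathProd X f (N + 1) = 1) := by
  obtain ⟨-, hsupp, -, -, hclosed, -, -, hcomm, -, -, hsq, -, hloop⟩ := h
  have hex : ∀ j k, ∃ x : Module.End ℂ C, G.Adj j k → Restricts (A j k) x := fun j k => by
    by_cases hjk : G.Adj j k
    · exact ⟨(Matrix.toLin' (A j k)).restrict fun φ hφ => by
        rw [Matrix.toLin'_apply]; exact hclosed j k hjk φ hφ,
        fun _ φ => by simp [LinearMap.restrict_apply]⟩
    · exact ⟨0, fun h => absurd h hjk⟩
  choose X hX using hex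
  refine ⟨X, hX, fun j k l m hjk hlm => ?_, fun j k hjk => ?_, fun j k hjk => ?_,
    fun N f hf hN => ?_⟩
  · ext1 φ
    apply Subtype.ext
    have := hcomm j k l m hjk hlm φ φ.2
    rw [Matrix.sub_mulVec, sub_eq_zero] at this
    rw [((hX j k hjk).mul (hX l m hlm)) φ, this]
    exact ((((hX l m hlm).mul (hX j k hjk)).smul _) φ).symm
  · ext1 φ
    apply Subtype.ext
    rw [((hX j k hjk).mul (hX j k hjk)) φ, ← sq, hsq j k hjk φ φ.2]
    rfl
  · ext1 φ
    apply Subtype.ext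
    rw [hX k j hjk.symm φ, (hsupp j k hjk).2, Matrix.neg_mulVec, LinearMap.neg_apply,
      Submodule.coe_neg, hX j k hjk φ]
  · have hval : ∀ t : Fin (N + 1), f ((t + 1 : Fin (N + 1)) : ℕ) = f (t + 1) := fun t => by
      rcases Fin.eq_castSucc_or_eq_last t with ⟨s, rfl⟩ | rfl
      · simp
      · simp [hN]
    have key := hloop N (fun t => f t) fun t => by
      rw [hval]
      exact hf t t.2
    simp only [hval] at key
    rw [prod_ofFn_eq_pathProd] at key
    ext1 φ
    apply Subtype.ext
    rw [((Restricts.pathProd fun t ht => hX _ _ (hf t ht)).smul _) φ, Matrix.smul_mulVec,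
      key φ φ.2]
    rfl

theorem isLocal_pathProd [Fintype V] [DecidableEq V] {G : SimpleGraph V}
    {A : V → V → Matrix (TIdx dim) (TIdx dim) ℂ}
    (hA : ∀ j k, G.Adj j k → SupportedOn dim {j, k} (A j k)) {f : ℕ → V} {n : ℕ} {S : Set V}
    (hf : ∀ t < n, G.Adj (f t) (f (t + 1))) (hS : ∀ t < n, f t ∈ S ∧ f (t + 1) ∈ S) :
    IsLocal S (Matrix.toLin' (pathProd A f n)) ∧ IsLocal S (Matrix.toLin' (revPathProd A f n)) := by
  have h1 : IsLocal S (Matrix.toLin' (1 : Matrix (TIdx dim) (TIdx dim) ℂ)) := by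
    rw [Matrix.toLin'_one]
    exact IsLocal.one S
  have hmul : ∀ M N : Matrix (TIdx dim) (TIdx dim) ℂ, IsLocal S (Matrix.toLin' M) →
      IsLocal S (Matrix.toLin' N) → IsLocal S (Matrix.toLin' (M * N)) := fun M N hM hN => by
    rw [Matrix.toLin'_mul]
    exact hM.mul hN
  have hedge : ∀ t < n, IsLocal S (Matrix.toLin' (A (f t) (f (t + 1)))) := fun t ht =>
    (hA _ _ (hf t ht)).isLocal.mono (by
      rintro v (rfl | rfl)
      exacts [(hS t ht).1, (hS t ht).2])
  exact ⟨pathProd_induction h1 hmul hedge, revPathProd_induction h1 hmul hedge⟩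

end Encoding

/-- Theorem 2, complexity of local block encodings: if the
connected graph `G` contains an 8-shaped subgraph (two vertices joined by three
edge-disjoint paths `i, j, k` of lengths `n, m, l`) of size `d`, witnessed by
`1 ≤ D < min n m l` such that no vertex is simultaneously within distance `d`
of `R_D` and within distance `d` of two or more of `I_D, J_D, K_D`, then the
code subspace of any local block encoding of the fermionic modes on `G`
contains no state `U ψ` with `ψ` a product state and `U` a circuit of local
two-body gates of depth at most `d`. -/
theorem code_space_no_low_depth_product_state
    {V : Type*} [Fintype V] [DecidableEq V]
    (G : SimpleGraph V) (hG : G.Connected)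
    (u w : V) (i j k : ℕ → V) (n m l : ℕ)
    (hi0 : i 0 = u) (hj0 : j 0 = u) (hk0 : k 0 = u)
    (hin : i n = w) (hjm : j m = w) (hkl : k l = w)
    (hiadj : ∀ t < n, G.Adj (i t) (i (t + 1)))
    (hjadj : ∀ t < m, G.Adj (j t) (j (t + 1)))
    (hkadj : ∀ t < l, G.Adj (k t) (k (t + 1)))
    (hipath : ∀ t ≤ n, ∀ t' ≤ n, i t = i t' → t = t')
    (hjpath : ∀ t ≤ m, ∀ t' ≤ m, j t = j t' → t = t')
    (hkpath : ∀ t ≤ l, ∀ t' ≤ l, k t = k t' → t = t')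
    (hij : pathEdges i 0 n ∩ pathEdges j 0 m = ∅)
    (hik : pathEdges i 0 n ∩ pathEdges k 0 l = ∅)
    (hjk : pathEdges j 0 m ∩ pathEdges k 0 l = ∅)
    (d D : ℕ) (hD1 : 1 ≤ D) (hDn : D < n) (hDm : D < m) (hDl : D < l)
    (hsize : ∀ x : V,
      ¬ (NearEdges G d x (pathEdges i D n ∪ pathEdges j D m ∪ pathEdges k D l) ∧
          ((NearEdges G d x (pathEdges i 0 D) ∧ NearEdges G d x (pathEdges j 0 D)) ∨
           (NearEdges G d x (pathEdges i 0 D) ∧ NearEdges G d x (pathEdges k 0 D)) ∨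
           (NearEdges G d x (pathEdges j 0 D) ∧ NearEdges G d x (pathEdges k 0 D)))))
    (dim : V → ℕ) (hdim : ∀ v, 0 < dim v)
    (A : V → V → Matrix (TIdx dim) (TIdx dim) ℂ)
    (B : V → Matrix (TIdx dim) (TIdx dim) ℂ)
    (C : Submodule ℂ (TIdx dim → ℂ))
    (henc : IsLocalBlockEncoding G dim A B C) :
    ∀ ψ : (v : V) → (Fin (dim v) → ℂ), (∀ v, ∑ x, ‖ψ v x‖ ^ 2 = 1) →
    ∀ U : Matrix (TIdx dim) (TIdx dim) ℂ, IsCircuitOfDepthLE G dim d U →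
      U.mulVec (fun x : TIdx dim => ∏ v, ψ v (x v)) ∉ C := by
  intro ψ hψ U hU hmem
  have hsupp := fun a b hab => (henc.2.1 a b hab).1
  obtain ⟨X, hX, hcomm, hsq, hanti, hloop⟩ := henc.exists_restrict
  have hUU : U * star U = 1 := Matrix.mem_unitaryGroup_iff.1 hU.mem_unitaryGroup
  have hUU' : star U * U = 1 := Matrix.mem_unitaryGroup_iff'.1 hU.mem_unitaryGroup
  have hy : ∀ v, ∃ x, ψ v x ≠ 0 := fun v => by
    by_contra! h0
    simpa [h0] using hψ v
  choose y hy using hy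
  let P : TIdx dim → ℂ := fun x => ∏ v, ψ v (x v)
  have hP0 : P ≠ 0 := fun h => Finset.prod_ne_zero_iff.2 (fun v _ => hy v) (congrFun h y)
  have hPU : P = partialProduct ψ Set.univ := by
    funext x
    simp [P, partialProduct]
  -- `φ` is the encoded state and `ι` undoes the circuit on the code space
  let φ : C := ⟨U.mulVec P, hmem⟩
  let ι : C → TIdx dim → ℂ := fun ξ => (star U).mulVec ξ
  have hιφ : ι φ = P := by
    simp only [ι, φ]
    rw [Matrix.mulVec_mulVec, hUU', Matrix.one_mulVec]
  have hι0 : ∀ ξ, ι ξ = 0 → ξ = 0 := fun ξ h => by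
    apply Subtype.ext
    have h' := congrArg U.mulVec h
    simp only [ι] at h'
    rw [Matrix.mulVec_mulVec, hUU, Matrix.one_mulVec, Matrix.mulVec_zero] at h'
    exact h'
  have hιneg : ∀ ξ, ι (-ξ) = -ι ξ := fun ξ => by
    simp only [ι]
    rw [Submodule.coe_neg, Matrix.mulVec_neg]
  have hpull : ∀ {M x}, Restricts (C := C) M x → ∀ ξ,
      Matrix.toLin' (star U * M * U) (ι ξ) = ι (x ξ) := fun {M x} hM ξ => by
    simp only [ι]
    rw [Matrix.toLin'_apply, Matrix.mulVec_mulVec, mul_assoc, hUU, mul_one, hM ξ,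
      Matrix.mulVec_mulVec]
  have hloc : ∀ {F : Set (Sym2 V)} {M},
      IsLocal {z | ∃ e ∈ F, z ∈ e} (Matrix.toLin' M) →
      IsLocal {x | NearEdges G d x F} (Matrix.toLin' (star U * M * U)) := fun hM =>
    hM.conj_circuit hG hU
  have hhead : ∀ {f : ℕ → V} {N}, (∀ t < N, G.Adj (f t) (f (t + 1))) → D < N →
      IsLocal {x | NearEdges G d x (pathEdges f 0 D)}
        (Matrix.toLin' (star U * pathProd A f D * U)) ∧
      IsLocal {x | NearEdges G d x (pathEdges f 0 D)}
        (Matrix.toLin' (star U * revPathProd A f D * U)) := fun {f N} hf hN => by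
    have h := isLocal_pathProd (S := {z | ∃ e ∈ pathEdges f 0 D, z ∈ e}) hsupp
      (fun t ht => hf t (ht.trans hN)) fun t ht =>
        ⟨⟨_, ⟨t, Nat.zero_le _, ht, rfl⟩, Sym2.mem_mk_left _ _⟩,
          ⟨_, ⟨t, Nat.zero_le _, ht, rfl⟩, Sym2.mem_mk_right _ _⟩⟩
    exact ⟨hloc h.1, hloc h.2⟩
  let R : Set (Sym2 V) := pathEdges i D n ∪ pathEdges j D m ∪ pathEdges k D l
  have htail : ∀ {f : ℕ → V} {N}, (∀ t < N, G.Adj (f t) (f (t + 1))) → pathEdges f D N ⊆ R →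
      IsLocal {z | ∃ e ∈ R, z ∈ e} (Matrix.toLin' (pathProd A (fun t => f (D + t)) (N - D))) ∧
      IsLocal {z | ∃ e ∈ R, z ∈ e}
        (Matrix.toLin' (revPathProd A (fun t => f (D + t)) (N - D))) := fun {f N} hf hR =>
    isLocal_pathProd hsupp (fun t ht => hf (D + t) (by omega)) fun t ht =>
      ⟨⟨_, hR ⟨D + t, by omega, by omega, rfl⟩, Sym2.mem_mk_left _ _⟩,
        ⟨_, hR ⟨D + t, by omega, by omega, rfl⟩, Sym2.mem_mk_right _ _⟩⟩
  have hRi : pathEdges i D n ⊆ R := fun e he => Or.inl (Or.inl he)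
  have hRj : pathEdges j D m ⊆ R := fun e he => Or.inl (Or.inr he)
  have hRk : pathEdges k D l ⊆ R := fun e he => Or.inr he
  -- two of the initial segments multiply to an operator on the remaining edges
  have hpair : ∀ {f g : ℕ → V} {N N'}, (∀ t < N, G.Adj (f t) (f (t + 1))) →
      (∀ t < N', G.Adj (g t) (g (t + 1))) → f 0 = g 0 → f N = g N' → D < N → D < N' →
      pathEdges f D N ⊆ R → pathEdges g D N' ⊆ R →
      ∃ M, IsLocal {x | NearEdges G d x R} (Matrix.toLin' (star U * M * U)) ∧
        Restricts M (pathProd X f D * pathProd X g D) :=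
      fun {f g N N'} hf hg h0 hN hDN hDN' hfR hgR => by
    obtain ⟨r, hr⟩ := exists_pathProd_mul_eq_smul (R := Module.End ℂ C) hcomm hsq hanti
      hloop hf hg h0 hN hDN hDN'
    refine ⟨r • (pathProd A (fun t => f (D + t)) (N - D) *
      revPathProd A (fun t => g (D + t)) (N' - D)), hloc ?_, ?_⟩
    · rw [map_smul, Matrix.toLin'_mul]
      exact ((htail hf hfR).1.mul (htail hg hgR).2).smul r
    · rw [hr]
      exact ((Restricts.pathProd fun t ht => hX _ _ (hf (D + t) (by omega))).mul
        (.revPathProd fun t ht => hX _ _ (hg (D + t) (by omega)))).smul r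
  have hanticomm : ∀ {f g : ℕ → V} {N N'}, (∀ t < N, G.Adj (f t) (f (t + 1))) →
      (∀ t < N', G.Adj (g t) (g (t + 1))) → (∀ t ≤ N, ∀ t' ≤ N, f t = f t' → t = t') →
      (∀ t ≤ N', ∀ t' ≤ N', g t = g t' → t = t') → f 0 = g 0 → D < N → D < N' →
      pathEdges f D N ⊆ R →
      (∀ x, ¬(NearEdges G d x R ∧ NearEdges G d x (pathEdges f 0 D) ∧
        NearEdges G d x (pathEdges g 0 D))) →
      pathProd X g D * pathProd X f D = -(pathProd X f D * pathProd X g D) :=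
      fun {f g N N'} hf hg hfi hgi h0 hDN hDN' hfR hfar => by
    refine pathProd_anticomm (R := Module.End ℂ C) hcomm (fun t ht => hf t (by omega))
      (fun t ht => hg t (by omega)) h0 (fun h => ?_) (fun h => ?_) fun h => hfar (f D) ⟨?_, ?_, ?_⟩
    · have := hgi 0 (by omega) D (by omega) (h0 ▸ h)
      omega
    · have := hfi D (by omega) 0 (by omega) (h.trans h0.symm)
      omega
    · exact ⟨f D, ⟨_, hfR ⟨D, le_rfl, hDN, rfl⟩, Sym2.mem_mk_left _ _⟩, by simp⟩
    · exact ⟨f (D - 1 + 1), ⟨_, ⟨D - 1, by omega, by omega, rfl⟩, Sym2.mem_mk_right _ _⟩, by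
        simp [Nat.sub_add_cancel hD1]⟩
    · exact ⟨g (D - 1 + 1), ⟨_, ⟨D - 1, by omega, by omega, rfl⟩, Sym2.mem_mk_right _ _⟩, by
        simp [Nat.sub_add_cancel hD1, h]⟩
  have hi0j : i 0 = j 0 := hi0.trans hj0.symm
  have hi0k : i 0 = k 0 := hi0.trans hk0.symm
  have hj0k : j 0 = k 0 := hj0.trans hk0.symm
  have farij := fun x (h : NearEdges G d x R ∧ NearEdges G d x (pathEdges i 0 D) ∧
    NearEdges G d x (pathEdges j 0 D)) => hsize x ⟨h.1, Or.inl h.2⟩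
  have farik := fun x (h : NearEdges G d x R ∧ NearEdges G d x (pathEdges i 0 D) ∧
    NearEdges G d x (pathEdges k 0 D)) => hsize x ⟨h.1, Or.inr (Or.inl h.2)⟩
  have farjk := fun x (h : NearEdges G d x R ∧ NearEdges G d x (pathEdges j 0 D) ∧
    NearEdges G d x (pathEdges k 0 D)) => hsize x ⟨h.1, Or.inr (Or.inr h.2)⟩
  have eji := hanticomm hiadj hjadj hipath hjpath hi0j hDn hDm hRi farij
  have eki := hanticomm hiadj hkadj hipath hkpath hi0k hDn hDl hRi farik
  have ekj := hanticomm hjadj hkadj hjpath hkpath hj0k hDm hDl hRj farjk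
  obtain ⟨Mij, hMij, rij⟩ := hpair hiadj hjadj hi0j (hin.trans hjm.symm) hDn hDm hRi hRj
  obtain ⟨Mik, hMik, rik⟩ := hpair hiadj hkadj hi0k (hin.trans hkl.symm) hDn hDl hRi hRk
  obtain ⟨Mjk, hMjk, rjk⟩ := hpair hjadj hkadj hj0k (hjm.trans hkl.symm) hDm hDl hRj hRk
  have hseg : ∀ {f : ℕ → V} {N}, (∀ t < N, G.Adj (f t) (f (t + 1))) → D < N →
      Restricts (pathProd A f D) (pathProd X f D) ∧
      Restricts (revPathProd A f D) (revPathProd X f D) ∧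
      ∀ ξ, revPathProd X f D (pathProd X f D ξ) = ξ := fun {f N} hf hN =>
    ⟨.pathProd fun t ht => hX _ _ (hf t (by omega)),
      .revPathProd fun t ht => hX _ _ (hf t (by omega)),
      fun ξ => LinearMap.congr_fun (revPathProd_mul_pathProd
        fun t ht => hsq _ _ (hf t (by omega))).1 ξ⟩
  obtain ⟨ra, ra', ia⟩ := hseg hiadj hDn
  obtain ⟨rb, rb', ib⟩ := hseg hjadj hDm
  obtain ⟨rc, rc', ic⟩ := hseg hkadj hDl
  obtain ⟨la, la'⟩ := hhead hiadj hDn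
  obtain ⟨lb, lb'⟩ := hhead hjadj hDm
  obtain ⟨lc, lc'⟩ := hhead hkadj hDl
  generalize pathProd X i D = a, pathProd X j D = b, pathProd X k D = c,
    revPathProd X i D = a', revPathProd X j D = b', revPathProd X k D = c' at *
  have eji' : ∀ ξ, b (a ξ) = -a (b ξ) := LinearMap.congr_fun eji
  have eki' : ∀ ξ, c (a ξ) = -a (c ξ) := LinearMap.congr_fun eki
  have ekj' : ∀ ξ, c (b ξ) = -b (c ξ) := LinearMap.congr_fun ekj
  refine no_fermionic_junction_of_product hy (fun x hR hI hJ => farij x ⟨hR, hI, hJ⟩)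
    (fun x hR hI hK => farik x ⟨hR, hI, hK⟩) (fun x hR hJ hK => farjk x ⟨hR, hJ, hK⟩)
    la lb lc la' lb' lc' hMij hMjk hMik hPU ?_ ?_ ?_ ?_ ?_ ?_ ?_ ?_ ?_ ?_ ?_ ?_ ?_ ?_ ?_
  all_goals
    rw [← hιφ]
    simp only [hpull ra, hpull rb, hpull rc, hpull ra', hpull rb', hpull rc', hpull rij, hpull rik,
      hpull rjk, ia, ib, ic, Module.End.mul_apply]
  · rw [eji', hιneg]
  · rw [eki', hιneg]
  · rw [ekj', hιneg]
  · rw [eki', ekj', map_neg, neg_neg]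
  · rw [eji', hιneg]
  intro h
  have h3 := hι0 _ h
  have h2 := ia (b (c φ))
  rw [h3, map_zero] at h2
  have h1 := ib (c φ)
  rw [← h2, map_zero] at h1
  have h0 := ic φ
  rw [← h1, map_zero] at h0
  apply hP0
  rw [← hιφ, ← h0]
  exact Matrix.mulVec_zero _
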